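/- For every integer N ≥ 1 and every Borel probability measure μ on [0,1] absolutely continuous with respect to Lebesgue measure with Riemann-integrable density, lim_{n→∞} μ(T_N^{-n}([0,x))) = log((x+N)/N)/log((N+1)/N) for every x ∈ [0,1] (Gauss–Kuzmin theorem for N-continued fractions). -/

import Mathlib

open MeasureTheory

noncomputable def TN (N : ℕ) (x : ℝ) : ℝ :=
  if x = 0 then 0 else (N : ℝ) / x - ⌊(N : ℝ) / x⌋

noncomputable def wt (N : ℕ) (k : ℕ) (y : ℝ) : ℝ := (y + N) / ((y + N + k) * (y + N + k + 1))
noncomputable def br (N : ℕ) (k : ℕ) (y : ℝ) : ℝ := N / (y + N + k)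
noncomputable def UN (N : ℕ) (f : ℝ → ℝ) (y : ℝ) : ℝ := ∑' k : ℕ, wt N k y * f (br N k y)
def LipI (f : ℝ → ℝ) (L : ℝ) : Prop :=
  ∀ x ∈ Set.Icc (0:ℝ) 1, ∀ y ∈ Set.Icc (0:ℝ) 1, |f x - f y| ≤ L * |x - y|

lemma br_mem {N : ℕ} (hN : 1 ≤ N) (k : ℕ) {y : ℝ} (hy : y ∈ Set.Icc (0:ℝ) 1) :
    br N k y ∈ Set.Icc (0:ℝ) 1 := by
  have h1 : (1:ℝ) ≤ N := by exact_mod_cast hN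
  have hk : (0:ℝ) ≤ k := by positivity
  obtain ⟨h0, _⟩ := hy
  unfold br
  constructor
  · positivity
  · rw [div_le_one (by positivity)]; linarith

lemma wt_nonneg {N : ℕ} (k : ℕ) {y : ℝ} (hy : 0 ≤ y) : 0 ≤ wt N k y := by
  unfold wt; positivity

noncomputable def RR (N : ℕ) (k : ℕ) (y : ℝ) : ℝ := (y + N) / (y + N + k)

lemma wt_eq {N : ℕ} (hN : 1 ≤ N) (k : ℕ) {y : ℝ} (hy : 0 ≤ y) :
    wt N k y = RR N k y - RR N (k+1) y := by
  have h1 : (1:ℝ) ≤ N := by exact_mod_cast hN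
  have hk : (0:ℝ) ≤ k := by positivity
  unfold wt RR
  have : y + N + k ≠ 0 := by positivity
  have : y + N + k + 1 ≠ 0 := by positivity
  have : y + N + (k + 1) ≠ 0 := by positivity
  push_cast
  field_simp
  ring

lemma RR_tendsto (N : ℕ) (y : ℝ) :
    Filter.Tendsto (fun k => RR N k y) Filter.atTop (nhds 0) := by
  unfold RR
  apply Filter.Tendsto.const_div_atTop
  exact Filter.tendsto_atTop_add_const_left _ _ tendsto_natCast_atTop_atTop

lemma wt_hasSum {N : ℕ} (hN : 1 ≤ N) {y : ℝ} (hy : 0 ≤ y) :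
    HasSum (fun k => wt N k y) 1 := by
  have h1 : (1:ℝ) ≤ N := by exact_mod_cast hN
  rw [hasSum_iff_tendsto_nat_of_nonneg (fun k => wt_nonneg k hy)]
  have : ∀ n : ℕ, ∑ i ∈ Finset.range n, wt N i y = 1 - RR N n y := by
    intro n
    rw [Finset.sum_congr rfl (fun i _ => wt_eq hN i hy), Finset.sum_range_sub' (fun k => RR N k y)]
    congr 1
    unfold RR
    have : y + N ≠ 0 := by positivity
    simp [this]
  simp_rw [this]
  simpa using (RR_tendsto N y).const_sub 1

lemma LipI.bdd {f : ℝ → ℝ} {L : ℝ} (hf : LipI f L) :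
    ∃ C, ∀ x ∈ Set.Icc (0:ℝ) 1, |f x| ≤ C := by
  refine ⟨|f 0| + |L|, fun x hx => ?_⟩
  have h := hf x hx 0 (by simp)
  have h2 : L * |x - 0| ≤ |L| := by
    rw [sub_zero, abs_of_nonneg hx.1]
    calc L * x ≤ |L| * x := mul_le_mul_of_nonneg_right (le_abs_self L) hx.1
      _ ≤ |L| * 1 := mul_le_mul_of_nonneg_left hx.2 (abs_nonneg L)
      _ = |L| := mul_one _
  have := abs_add_le (f x - f 0) (f 0)
  simp only [sub_add_cancel] at this
  linarith

lemma U_summable {N : ℕ} (hN : 1 ≤ N) {f : ℝ → ℝ} {L : ℝ} (hf : LipI f L)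
    {y : ℝ} (hy : y ∈ Set.Icc (0:ℝ) 1) :
    Summable (fun k => wt N k y * f (br N k y)) := by
  obtain ⟨C, hC⟩ := hf.bdd
  refine Summable.of_norm_bounded (g := fun k => wt N k y * C)
    ((wt_hasSum hN hy.1).summable.mul_right C) (fun k => ?_)
  rw [Real.norm_eq_abs, abs_mul, abs_of_nonneg (wt_nonneg k hy.1)]
  exact mul_le_mul_of_nonneg_left (hC _ (br_mem hN k hy)) (wt_nonneg k hy.1)

lemma term_bound {n b b' k : ℝ} (hn : 0 ≤ n) (h1 : 1 ≤ b) (hb : b ≤ b') (hnb : n ≤ b)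
    (hk : 0 ≤ k) :
    b / ((b+k)*(b+k+1)) * (n / ((b+k)*(b'+k)))
      + (k+1) / ((b+k+1)*(b'+k+1)) * (n / ((b'+k+1)*(b'+k)))
    ≤ (b / (2*(b+k)^2) + 3/7 * b^2/(b+k)^3)
      - (b / (2*(b+k+1)^2) + 3/7 * b^2/(b+k+1)^3) := by
  have e1 : b / ((b+k)*(b+k+1)) * (n / ((b+k)*(b'+k)))
      ≤ b / ((b+k)*(b+k+1)) * (b / ((b+k)*(b+k))) := by gcongr
  have e2 : (k+1) / ((b+k+1)*(b'+k+1)) * (n / ((b'+k+1)*(b'+k))) ≤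
      (k+1) / ((b+k+1)*(b+k+1)) * (b / ((b+k+1)*(b+k))) := by
    have hb' : 0 < b' := by linarith
    gcongr
  obtain ⟨a, rfl⟩ : ∃ a, k = a - b := ⟨b + k, by ring⟩
  have ha : 1 ≤ a := by linarith
  simp only [add_sub_cancel] at *
  refine (add_le_add e1 e2).trans ?_
  rw [← sub_nonneg]
  have : (b / (2*a^2) + 3/7 * b^2/a^3) - (b / (2*(a+1)^2) + 3/7 * b^2/(a+1)^3)
      - (b / (a*(a+1)) * (b / (a*a)) + (a-b+1) / ((a+1)*(a+1)) * (b / ((a+1)*a)))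
      = b / (2 * a^2*(a+1)^2) + b^2 * (9*a^2 - 5 * a - 4) / (7 * a^3*(a+1)^3) := by
    field_simp
    ring
  rw [this]
  have : 0 ≤ 9*a^2 - 5 * a - 4 := by nlinarith
  positivity

lemma abel (D F : ℕ → ℝ) (hD : D 0 = 0) (n : ℕ) :
    ∑ k ∈ Finset.range n, (D k - D (k+1)) * F k
      = ∑ k ∈ Finset.range n, D (k+1) * (F (k+1) - F k) - D n * F n := by
  induction n with
  | zero => simp [hD]
  | succ n ih => rw [Finset.sum_range_succ, Finset.sum_range_succ, ih]; ring

lemma U_lip_aux {N : ℕ} (hN : 1 ≤ N) {f : ℝ → ℝ} {L : ℝ} (hf : LipI f L) (hL : 0 ≤ L)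
    {x y : ℝ} (hx : x ∈ Set.Icc (0:ℝ) 1) (hy : y ∈ Set.Icc (0:ℝ) 1) (hxy : x ≤ y) :
    |UN N f x - UN N f y| ≤ 13/14 * L * |x - y| := by
  have h1 : (1:ℝ) ≤ N := by exact_mod_cast hN
  obtain ⟨C, hC⟩ := hf.bdd
  have hx0 := hx.1
  have hy0 := hy.1
  set D : ℕ → ℝ := fun k => RR N k x - RR N k y with hDdef
  have hD0 : D 0 = 0 := by
    have h2 : x + N ≠ 0 := by positivity
    have h3 : y + N ≠ 0 := by positivity
    simp [hDdef, RR, h2, h3]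
  set F : ℕ → ℝ := fun k => f (br N k y) with hFdef
  set G : ℕ → ℝ := fun k => (x+N) / (2*(x+N+k)^2) + 3/7 * (x+N)^2/(x+N+k)^3 with hG
  have key : ∀ k : ℕ, |wt N k x * (f (br N k x) - f (br N k y)) + D (k+1) * (F (k+1) - F k)|
      ≤ L * |x - y| * (G k - G (k+1)) := by
    intro k
    have hk : (0:ℝ) ≤ k := by positivity
    have t1 : |f (br N k x) - f (br N k y)| ≤ L * (|x-y| * (N / ((x+N+k)*(y+N+k)))) := by
      refine (hf _ (br_mem hN k hx) _ (br_mem hN k hy)).trans_eq ?_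
      have : br N k x - br N k y = -((x-y) * (N / ((x+N+k)*(y+N+k)))) := by
        unfold br
        have : x + N + k ≠ 0 := by positivity
        have : y + N + k ≠ 0 := by positivity
        field_simp
        ring
      rw [this, abs_neg, abs_mul, abs_of_nonneg (a := N / ((x+N+k)*(y+N+k))) (by positivity)]
    have t2 : |F (k+1) - F k| ≤ L * (N / ((y+N+k+1)*(y+N+k))) := by
      refine (hf _ (br_mem hN (k+1) hy) _ (br_mem hN k hy)).trans_eq ?_
      have : br N (k+1) y - br N k y = -(N / ((y+N+k+1)*(y+N+k))) := by
        unfold br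
        have : y + N + k + 1 ≠ 0 := by positivity
        have : y + N + (k + 1) ≠ 0 := by positivity
        have : y + N + k ≠ 0 := by positivity
        push_cast
        field_simp
        ring
      rw [this, abs_neg, abs_of_nonneg (a := N / ((y+N+k+1)*(y+N+k))) (by positivity)]
    have t3 : |D (k+1)| = |x-y| * ((k+1) / ((x+N+k+1)*(y+N+k+1))) := by
      have : D (k+1) = (x-y) * ((k+1) / ((x+N+k+1)*(y+N+k+1))) := by
        simp only [hDdef, RR]
        have : x + N + k + 1 ≠ 0 := by positivity
        have : x + N + (k + 1) ≠ 0 := by positivity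
        have : y + N + k + 1 ≠ 0 := by positivity
        have : y + N + (k + 1) ≠ 0 := by positivity
        push_cast
        field_simp
        ring
      rw [this, abs_mul, abs_of_nonneg (a := (k+1) / ((x+N+k+1)*(y+N+k+1))) (by positivity)]
    have tb := term_bound (n := N) (b := x + N) (b' := y + N) (k := k) (by positivity)
      (by linarith) (by linarith) (by linarith) hk
    have hGG : G k - G (k+1) = ((x+N) / (2*(x+N+k)^2) + 3/7 * (x+N)^2/(x+N+k)^3)
      - ((x+N) / (2*(x+N+k+1)^2) + 3/7 * (x+N)^2/(x+N+k+1)^3) := by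
      simp only [hG]; push_cast; ring_nf
    rw [hGG]
    refine le_trans ?_ (mul_le_mul_of_nonneg_left tb (by positivity))
    refine (abs_add_le _ _).trans ?_
    rw [abs_mul, abs_mul, abs_of_nonneg (wt_nonneg k hx0), t3]
    have s1 := mul_le_mul_of_nonneg_left t1 (wt_nonneg (N := N) k hx0)
    have s2 := mul_le_mul_of_nonneg_left t2
      (show 0 ≤ |x-y| * ((k+1) / ((x+N+k+1)*(y+N+k+1))) by positivity)
    refine (add_le_add s1 s2).trans_eq ?_
    unfold wt
    ring
  have fin : ∀ n : ℕ, |∑ k ∈ Finset.range n, wt N k x * f (br N k x)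
      - ∑ k ∈ Finset.range n, wt N k y * f (br N k y)| ≤ 13/14 * L * |x-y| + |D n| * C := by
    intro n
    have e : ∑ k ∈ Finset.range n, wt N k x * f (br N k x)
      - ∑ k ∈ Finset.range n, wt N k y * f (br N k y)
      = ∑ k ∈ Finset.range n, (wt N k x * (f (br N k x) - f (br N k y)) + D (k+1) * (F (k+1) - F k))
        - D n * F n := by
      rw [Finset.sum_add_distrib, add_sub_assoc, ← abel D F hD0, ← Finset.sum_sub_distrib,
        ← Finset.sum_add_distrib]
      refine Finset.sum_congr rfl fun k _ => ?_
      have : D k - D (k+1) = wt N k x - wt N k y := by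
        rw [wt_eq hN k hx0, wt_eq hN k hy0]; simp only [hDdef]; ring
      rw [this]; simp only [hFdef]; ring
    rw [e]
    refine (abs_sub _ _).trans ?_
    apply add_le_add
    · refine (Finset.abs_sum_le_sum_abs _ _).trans ?_
      refine (Finset.sum_le_sum (fun k _ => key k)).trans ?_
      rw [← Finset.mul_sum, Finset.sum_range_sub']
      have g0 : G 0 ≤ 13/14 := by
        simp only [hG]
        have : x + N ≠ 0 := by positivity
        have e : (x+N) / (2*(x+N+(0:ℕ))^2) + 3/7 * (x+N)^2/(x+N+(0:ℕ))^3 = 13/14 / (x+N) := by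
          push_cast; rw [add_zero]; field_simp; norm_num
        rw [e]
        apply div_le_self <;> linarith
      have gn : 0 ≤ G n := by simp only [hG]; positivity
      have := mul_le_mul_of_nonneg_left (show G 0 - G n ≤ 13/14 by linarith)
        (show 0 ≤ L * |x-y| by positivity)
      linarith
    · rw [abs_mul]
      exact mul_le_mul_of_nonneg_left (hC _ (br_mem hN n hy)) (abs_nonneg _)
  have lim1 := (((U_summable hN hf hx).hasSum.tendsto_sum_nat).sub
    ((U_summable hN hf hy).hasSum.tendsto_sum_nat)).abs
  have lim2 : Filter.Tendsto (fun n => 13/14 * L * |x-y| + |D n| * C) Filter.atTop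
      (nhds (13/14 * L * |x-y| + |(0:ℝ) - 0| * C)) :=
    ((((RR_tendsto N x).sub (RR_tendsto N y)).abs).mul_const C).const_add _
  have := le_of_tendsto_of_tendsto' lim1 lim2 fin
  simpa [UN] using this

lemma U_lip {N : ℕ} (hN : 1 ≤ N) {f : ℝ → ℝ} {L : ℝ} (hf : LipI f L) (hL : 0 ≤ L) :
    LipI (UN N f) (13/14 * L) := by
  intro x hx y hy
  rcases le_total x y with h | h
  · exact U_lip_aux hN hf hL hx hy h
  · rw [abs_sub_comm, abs_sub_comm x]; exact U_lip_aux hN hf hL hy hx h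

lemma U_nonneg {N : ℕ} (hN : 1 ≤ N) {f : ℝ → ℝ} (hf : ∀ x ∈ Set.Icc (0:ℝ) 1, 0 ≤ f x) :
    ∀ x ∈ Set.Icc (0:ℝ) 1, 0 ≤ UN N f x := fun _ hx =>
  tsum_nonneg fun k => mul_nonneg (wt_nonneg k hx.1) (hf _ (br_mem hN k hx))

lemma br_pos {N : ℕ} (hN : 1 ≤ N) (k : ℕ) {y : ℝ} (hy : 0 ≤ y) : 0 < br N k y := by
  have h1 : (1:ℝ) ≤ N := by exact_mod_cast hN
  unfold br; positivity

lemma div_br {N : ℕ} (hN : 1 ≤ N) (k : ℕ) {y : ℝ} (hy : 0 ≤ y) :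
    N / br N k y = y + ((N + k : ℕ) : ℤ) := by
  have h1 : (1:ℝ) ≤ N := by exact_mod_cast hN
  have : y + N + k ≠ 0 := by positivity
  unfold br; push_cast; field_simp; ring

lemma floor_br {N : ℕ} (hN : 1 ≤ N) (k : ℕ) {y : ℝ} (hy : y ∈ Set.Ico (0:ℝ) 1) :
    ⌊N / br N k y⌋ = ((N + k : ℕ) : ℤ) := by
  rw [div_br hN k hy.1, Int.floor_add_intCast, Int.floor_eq_zero_iff.2 hy, zero_add]

lemma TN_br {N : ℕ} (hN : 1 ≤ N) (k : ℕ) {y : ℝ} (hy : y ∈ Set.Ico (0:ℝ) 1) :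
    TN N (br N k y) = y := by
  rw [TN, if_neg (br_pos hN k hy.1).ne', floor_br hN k hy, div_br hN k hy.1]
  ring

lemma TN_mem (N : ℕ) (x : ℝ) : TN N x ∈ Set.Ico (0:ℝ) 1 := by
  unfold TN
  split_ifs
  · simp
  · exact ⟨Int.fract_nonneg _, Int.fract_lt_one _⟩

lemma TN_meas (N : ℕ) : Measurable (TN N) := by
  unfold TN
  refine Measurable.ite (measurableSet_singleton 0) measurable_const ?_
  have : Measurable fun x : ℝ => (N:ℝ) / x := measurable_const.div measurable_id
  exact this.sub ((measurable_from_top (f := fun z : ℤ => (z:ℝ))).comp (Int.measurable_floor.comp this))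

lemma preim_eq {N : ℕ} (hN : 1 ≤ N) (E : Set ℝ) :
    TN N ⁻¹' E ∩ Set.Ioc 0 1 = ⋃ k : ℕ, br N k '' (E ∩ Set.Ico 0 1) := by
  have h1 : (1:ℝ) ≤ N := by exact_mod_cast hN
  ext x
  simp only [Set.mem_inter_iff, Set.mem_preimage, Set.mem_iUnion, Set.mem_image]
  constructor
  · rintro ⟨hE, hx⟩
    have hfl : (N : ℤ) ≤ ⌊(N:ℝ) / x⌋ := by
      rw [Int.le_floor]
      push_cast
      rw [le_div_iff₀ hx.1]
      nlinarith [hx.2]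
    obtain ⟨k, hk⟩ := Int.le.dest hfl
    refine ⟨k, TN N x, ⟨hE, TN_mem N x⟩, ?_⟩
    have hk' : (N:ℝ) + k = ⌊(N:ℝ) / x⌋ := by exact_mod_cast hk
    rw [br, TN, if_neg hx.1.ne', add_assoc, hk', sub_add_cancel]
    have := hx.1.ne'
    field_simp
  · rintro ⟨k, y, ⟨hE, hy⟩, rfl⟩
    rw [TN_br hN k hy]
    exact ⟨hE, br_pos hN k hy.1, (br_mem hN k (Set.Ico_subset_Icc_self hy)).2⟩

lemma br_inj {N : ℕ} (hN : 1 ≤ N) (k : ℕ) : Set.InjOn (br N k) (Set.Ico 0 1) := by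
  intro y hy y' hy' h
  rw [← TN_br hN k hy, h, TN_br hN k hy']

lemma br_deriv {N : ℕ} (hN : 1 ≤ N) (k : ℕ) {y : ℝ} (hy : 0 ≤ y) :
    HasDerivAt (br N k) (-(N / (y + N + k)^2)) y := by
  have h1 : (1:ℝ) ≤ N := by exact_mod_cast hN
  have h2 : y + N + k ≠ 0 := by positivity
  have := (((hasDerivAt_id y).add_const (N:ℝ)).add_const (k:ℝ)).inv h2 |>.const_mul (N:ℝ)
  have e : -((N:ℝ) / (y + N + k)^2) = N * (-1 / (y + N + k)^2) := by ring
  rw [e]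
  exact this

lemma LipI.contOn {f : ℝ → ℝ} {L : ℝ} (hf : LipI f L) (hL : 0 ≤ L) :
    ContinuousOn f (Set.Icc 0 1) := by
  have : LipschitzOnWith ⟨L, hL⟩ f (Set.Icc 0 1) := by
    apply LipschitzOnWith.of_dist_le_mul
    intro x hx y hy
    exact hf x hx y hy
  exact this.continuousOn

lemma transfer {N : ℕ} (hN : 1 ≤ N) {f : ℝ → ℝ} {L : ℝ} (hf : LipI f L) (hL : 0 ≤ L)
    (hf0 : ∀ x ∈ Set.Icc (0:ℝ) 1, 0 ≤ f x) {E : Set ℝ} (hE : MeasurableSet E) :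
    ∫⁻ x in TN N ⁻¹' E ∩ Set.Ico 0 1, ENNReal.ofReal (f x / (x + N))
      = ∫⁻ x in E ∩ Set.Ico 0 1, ENNReal.ofReal (UN N f x / (x + N)) := by
  have h1 : (1:ℝ) ≤ N := by exact_mod_cast hN
  have hES : MeasurableSet (E ∩ Set.Ico (0:ℝ) 1) := hE.inter measurableSet_Ico
  have hcont : ∀ k, ContinuousOn (br N k) (Set.Icc 0 1) := fun k y hy =>
    (br_deriv hN k hy.1).continuousAt.continuousWithinAt
  have a1 : ∫⁻ x in TN N ⁻¹' E ∩ Set.Ico 0 1, ENNReal.ofReal (f x / (x + N))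
      = ∫⁻ x in TN N ⁻¹' E ∩ Set.Ioc 0 1, ENNReal.ofReal (f x / (x + N)) := by
    apply setLIntegral_congr
    exact (Filter.EventuallyEq.refl _ _).inter (Ico_ae_eq_Ioc)
  rw [a1, preim_eq hN, lintegral_iUnion]
  rotate_left
  · intro k
    refine hES.image_of_continuousOn_injOn ((hcont k).mono ?_) ((br_inj hN k).mono ?_)
    · exact Set.inter_subset_right.trans Set.Ico_subset_Icc_self
    · exact Set.inter_subset_right
  · intro k k' hkk
    refine Set.disjoint_left.2 ?_
    rintro _ ⟨y, hy, rfl⟩ ⟨y', hy', h⟩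
    have e1 := floor_br hN k hy.2
    rw [← h, floor_br hN k' hy'.2] at e1
    apply hkk
    have : N + k' = N + k := by exact_mod_cast e1
    omega
  have a2 : ∀ k : ℕ, ∫⁻ x in br N k '' (E ∩ Set.Ico 0 1), ENNReal.ofReal (f x / (x + N))
      = ∫⁻ y in E ∩ Set.Ico 0 1, ENNReal.ofReal (wt N k y * f (br N k y) / (y + N)) := by
    intro k
    rw [lintegral_image_eq_lintegral_abs_deriv_mul hES
      (f' := fun y => -(N / (y + N + k)^2))
      (fun y hy => (br_deriv hN k hy.2.1).hasDerivWithinAt)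
      ((br_inj hN k).mono Set.inter_subset_right)]
    refine setLIntegral_congr_fun hES fun y hy => ?_
    have hy0 : 0 ≤ y := hy.2.1
    rw [← ENNReal.ofReal_mul (abs_nonneg _), abs_neg, abs_of_nonneg (by positivity)]
    congr 1
    unfold wt br
    have : y + N + k ≠ 0 := by positivity
    have : y + N + k + 1 ≠ 0 := by positivity
    have : y + N ≠ 0 := by positivity
    have : (N:ℝ) / (y + N + k) + N ≠ 0 := by positivity
    have : (N:ℝ) / (y + N + k) + N = N * (y + N + k + 1) / (y + N + k) := by field_simp; ring
    rw [this]
    field_simp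
  simp_rw [a2]
  rw [← lintegral_tsum]
  · refine setLIntegral_congr_fun hES fun y hy => ?_
    have hyI := Set.Ico_subset_Icc_self hy.2
    have hy0 : 0 ≤ y := hy.2.1
    rw [← ENNReal.ofReal_tsum_of_nonneg]
    · rw [tsum_div_const]; rfl
    · intro k
      exact div_nonneg (mul_nonneg (wt_nonneg k hy0) (hf0 _ (br_mem hN k hyI))) (by positivity)
    · exact (U_summable hN hf hyI).div_const _
  · intro k
    apply AEMeasurable.ennreal_ofReal
    apply ContinuousOn.aemeasurable _ hES
    refine ContinuousOn.mono (s := Set.Icc (0:ℝ) 1) ?_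
      (Set.inter_subset_right.trans Set.Ico_subset_Icc_self)
    have hc : ContinuousOn (fun y => f (br N k y)) (Set.Icc (0:ℝ) 1) :=
      (hf.contOn hL).comp (hcont k) (fun y hy => br_mem hN k hy)
    refine ContinuousOn.div (ContinuousOn.mul ?_ hc) (by fun_prop) ?_
    · unfold wt
      refine ContinuousOn.div (by fun_prop) (by fun_prop) ?_
      intro y hy
      have := hy.1
      positivity
    · intro y hy
      have := hy.1
      positivity

lemma U_iter {N : ℕ} (hN : 1 ≤ N) (n : ℕ) : ∀ {f : ℝ → ℝ} {L : ℝ}, LipI f L → 0 ≤ L →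
    (∀ x ∈ Set.Icc (0:ℝ) 1, 0 ≤ f x) → ∃ g : ℝ → ℝ, LipI g ((13/14)^n * L) ∧
      (∀ x ∈ Set.Icc (0:ℝ) 1, 0 ≤ g x) ∧ ∀ E : Set ℝ, MeasurableSet E →
    ∫⁻ x in (TN N)^[n] ⁻¹' E ∩ Set.Ico 0 1, ENNReal.ofReal (f x / (x + N))
      = ∫⁻ x in E ∩ Set.Ico 0 1, ENNReal.ofReal (g x / (x + N)) := by
  induction n with
  | zero => intro f L h1 _ h3; exact ⟨f, by simpa using h1, h3, by simp⟩
  | succ n ih =>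
    intro f L h1 h2 h3
    obtain ⟨g, hg1, hg2, hg3⟩ := ih (U_lip hN h1 h2) (by positivity) (U_nonneg hN h3)
    refine ⟨g, by convert hg1 using 1; ring, hg2, fun E hE => ?_⟩
    rw [← hg3 E hE, ← transfer hN h1 h2 h3 (((TN_meas N).iterate n) hE)]
    rw [← Set.preimage_comp, ← Function.iterate_succ]

/-- Real-valued integral. -/
noncomputable def II (N : ℕ) (f : ℝ → ℝ) (E : Set ℝ) : ℝ :=
  ∫ x in E ∩ Set.Ico 0 1, f x / (x + N)

lemma II_integrable {N : ℕ} (hN : 1 ≤ N) {f : ℝ → ℝ} {L : ℝ} (hf : LipI f L) (hL : 0 ≤ L)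
    (E : Set ℝ) : IntegrableOn (fun x => f x / (x + N)) (E ∩ Set.Ico 0 1) := by
  have h1 : (1:ℝ) ≤ N := by exact_mod_cast hN
  have : ContinuousOn (fun x => f x / (x + N)) (Set.Icc 0 1) := by
    refine (hf.contOn hL).div (by fun_prop) ?_
    intro y hy
    have := hy.1
    positivity
  exact (this.integrableOn_Icc (μ := volume)).mono_set
    (Set.inter_subset_right.trans Set.Ico_subset_Icc_self)

lemma II_toReal {N : ℕ} (hN : 1 ≤ N) {f : ℝ → ℝ} {L : ℝ} (hf : LipI f L) (hL : 0 ≤ L)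
    (hf0 : ∀ x ∈ Set.Icc (0:ℝ) 1, 0 ≤ f x) {E : Set ℝ} (hE : MeasurableSet E) :
    (∫⁻ x in E ∩ Set.Ico 0 1, ENNReal.ofReal (f x / (x + N))).toReal = II N f E := by
  have hES : MeasurableSet (E ∩ Set.Ico (0:ℝ) 1) := hE.inter measurableSet_Ico
  rw [II, integral_eq_lintegral_of_nonneg_ae]
  · refine (ae_restrict_iff' hES).2 (Filter.Eventually.of_forall fun x hx => ?_)
    have := hx.2.1
    exact div_nonneg (hf0 x (Set.Ico_subset_Icc_self hx.2)) (by positivity)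
  · exact (II_integrable hN hf hL E).aestronglyMeasurable

lemma LipI_const (c : ℝ) : LipI (fun _ => c) 0 := by intro x _ y _; simp

lemma II_close {N : ℕ} (hN : 1 ≤ N) {g : ℝ → ℝ} {L : ℝ} (hg : LipI g L) (hL : 0 ≤ L)
    {E : Set ℝ} (hE : MeasurableSet E) :
    |II N g E - g 0 * II N (fun _ => 1) E| ≤ L := by
  have h1 : (1:ℝ) ≤ N := by exact_mod_cast hN
  have hES : MeasurableSet (E ∩ Set.Ico (0:ℝ) 1) := hE.inter measurableSet_Ico
  unfold II
  rw [← integral_const_mul, ← integral_sub (II_integrable hN hg hL E)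
    ((II_integrable hN (LipI_const 1) le_rfl E).const_mul _)]
  have hv : volume (E ∩ Set.Ico (0:ℝ) 1) ≤ 1 := by
    refine (measure_mono Set.inter_subset_right).trans ?_
    simp
  have := norm_setIntegral_le_of_norm_le_const (μ := volume) (s := E ∩ Set.Ico (0:ℝ) 1)
    (f := fun x => g x / (x + N) - g 0 * (1 / (x + N))) (C := L) (hv.trans_lt (by simp)) ?_
  · refine this.trans ?_
    have : volume.real (E ∩ Set.Ico (0:ℝ) 1) ≤ 1 := by
      exact ENNReal.toReal_le_of_le_ofReal zero_le_one (by simpa using hv)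
    exact mul_le_of_le_one_right hL this
  · intro x hx
    have hx0 := hx.2.1
    have hx1 := hx.2.2
    have : g x / (x + N) - g 0 * (1 / (x + N)) = (g x - g 0) / (x + N) := by ring
    rw [this, Real.norm_eq_abs, abs_div, abs_of_nonneg (a := x + N) (by positivity)]
    refine (div_le_self (abs_nonneg _) (by linarith)).trans ?_
    refine (hg x (Set.Ico_subset_Icc_self hx.2) 0 (by simp)).trans ?_
    rw [sub_zero, abs_of_nonneg hx0]
    exact mul_le_of_le_one_right hL hx1.le

lemma II_one {N : ℕ} (hN : 1 ≤ N) {x : ℝ} (hx : x ∈ Set.Icc (0:ℝ) 1) :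
    II N (fun _ => 1) (Set.Ico 0 x) = Real.log ((x + N) / N) := by
  have h1 : (1:ℝ) ≤ N := by exact_mod_cast hN
  have : Set.Ico 0 x ∩ Set.Ico (0:ℝ) 1 = Set.Ico 0 x := by
    apply Set.inter_eq_left.2
    exact Set.Ico_subset_Ico_right hx.2
  rw [II, this, integral_Ico_eq_integral_Ioc, ← intervalIntegral.integral_of_le hx.1,
    intervalIntegral.integral_comp_add_right (fun t => 1 / t), integral_one_div_of_pos, zero_add]
  · linarith
  · linarith [hx.1]

lemma lip_limit {N : ℕ} (hN : 1 ≤ N) {f : ℝ → ℝ} {L : ℝ} (hf : LipI f L) (hL : 0 ≤ L)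
    (hf0 : ∀ x ∈ Set.Icc (0:ℝ) 1, 0 ≤ f x) {x : ℝ} (hx : x ∈ Set.Icc (0:ℝ) 1) :
    Filter.Tendsto (fun n => II N f ((TN N)^[n] ⁻¹' Set.Ico 0 x)) Filter.atTop
      (nhds (Real.log ((x + N) / N) / Real.log ((N + 1) / N) * II N f Set.univ)) := by
  have h1 : (1:ℝ) ≤ N := by exact_mod_cast hN
  set l := Real.log ((N + 1) / N) with hl
  have hlpos : 0 < l := Real.log_pos (by rw [lt_div_iff₀ (by positivity)]; linarith)
  set r := Real.log ((x + N) / N) with hr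
  have key : ∀ n : ℕ, |II N f ((TN N)^[n] ⁻¹' Set.Ico 0 x) - r / l * II N f Set.univ|
      ≤ (13/14)^n * (L * (1 + |r / l|)) := by
    intro n
    obtain ⟨g, hg1, hg2, hg3⟩ := U_iter hN n hf hL hf0
    have hL' : 0 ≤ (13/14)^n * L := by positivity
    have e1 : II N f ((TN N)^[n] ⁻¹' Set.Ico 0 x) = II N g (Set.Ico 0 x) := by
      rw [← II_toReal hN hf hL hf0 ((TN_meas N).iterate n measurableSet_Ico),
        ← II_toReal hN hg1 hL' hg2 measurableSet_Ico, hg3 _ measurableSet_Ico]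
    have e2 : II N f Set.univ = II N g Set.univ := by
      rw [← II_toReal hN hf hL hf0 MeasurableSet.univ,
        ← II_toReal hN hg1 hL' hg2 MeasurableSet.univ, ← hg3 _ MeasurableSet.univ, Set.preimage_univ]
    have e3 : II N (fun _ => 1) Set.univ = l := by
      have : II N (fun _ => 1) Set.univ = II N (fun _ => 1) (Set.Ico 0 1) := by simp [II]
      rw [this, II_one hN (by simp), add_comm]
    have c1 := II_close hN hg1 hL' (measurableSet_Ico (a := (0:ℝ)) (b := x))
    have c2 := II_close hN hg1 hL' MeasurableSet.univ
    rw [II_one hN hx] at c1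
    rw [e3] at c2
    rw [e1, e2]
    have : II N g (Set.Ico 0 x) - r / l * II N g Set.univ
      = (II N g (Set.Ico 0 x) - g 0 * r) - r / l * (II N g Set.univ - g 0 * l) := by
      field_simp; ring
    rw [this]
    refine (abs_sub _ _).trans ?_
    rw [abs_mul]
    have := mul_le_mul_of_nonneg_left c2 (abs_nonneg (r / l))
    linarith
  rw [tendsto_iff_dist_tendsto_zero]
  refine squeeze_zero (fun _ => dist_nonneg) key ?_
  simpa using (tendsto_pow_atTop_nhds_zero_of_lt_one (r := (13/14:ℝ)) (by norm_num)
    (by norm_num)).mul_const (L * (1 + |r / l|))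

lemma exists_lip_poly (N : ℕ) (p : Polynomial ℝ) :
    ∃ L, 0 ≤ L ∧ LipI (fun x => max ((x + N) * p.eval x) 0) L := by
  have hc : ContDiff ℝ 1 (fun x : ℝ => (x + N) * p.eval x) := by
    have : ContDiff ℝ 1 (fun x : ℝ => p.eval x) := by
      simpa using p.contDiff_aeval (𝕜 := ℝ) (n := 1)
    fun_prop
  obtain ⟨K, hK⟩ := hc.locallyLipschitz.locallyLipschitzOn.exists_lipschitzOnWith_of_compact
    (isCompact_Icc (a := (0:ℝ)) (b := 1))
  refine ⟨K, K.2, fun x hx y hy => ?_⟩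
  refine (abs_max_sub_max_le_abs _ _ _).trans ?_
  exact hK.dist_le_mul x hx y hy

lemma aemeas_of_ae_cont {h : ℝ → ℝ} {s : Set ℝ}
    (hae : ∀ᵐ x ∂(volume.restrict s), ContinuousAt h x) :
    AEMeasurable h (volume.restrict s) := by
  have hm : MeasurableSet {x | ContinuousAt h x} := (IsGδ.setOfPred_continuousAt h).measurableSet
  have h1 : AEMeasurable h ((volume.restrict s).restrict {x | ContinuousAt h x}) :=
    ContinuousOn.aemeasurable (fun x hx => ContinuousAt.continuousWithinAt hx) hm
  rwa [Measure.restrict_eq_self_of_ae_mem (s := {x | ContinuousAt h x}) hae] at h1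

lemma approx {N : ℕ} (hN : 1 ≤ N) {u : ℝ → ℝ} (hu : IntegrableOn u (Set.Icc 0 1))
    (hu0 : ∀ x, 0 ≤ u x) {ε : ℝ} (hε : 0 < ε) :
    ∃ f L, 0 ≤ L ∧ LipI f L ∧ (∀ x ∈ Set.Icc (0:ℝ) 1, 0 ≤ f x) ∧
      ∀ A, MeasurableSet A → |(∫ x in A ∩ Set.Ico 0 1, u x) - II N f A| ≤ 2 * ε := by
  have h1 : (1:ℝ) ≤ N := by exact_mod_cast hN
  obtain ⟨g, -, hg1, hg2, hg3⟩ := hu.exists_hasCompactSupport_integral_sub_le hε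
  obtain ⟨p, hp⟩ := exists_polynomial_near_of_continuousOn 0 1 g hg2.continuousOn ε hε
  obtain ⟨L, hL, hlip⟩ := exists_lip_poly N p
  refine ⟨_, L, hL, hlip, fun x _ => le_max_right _ _, fun A hA => ?_⟩
  have hsub : A ∩ Set.Ico (0:ℝ) 1 ⊆ Set.Icc 0 1 :=
    Set.inter_subset_right.trans Set.Ico_subset_Icc_self
  have hAS : MeasurableSet (A ∩ Set.Ico (0:ℝ) 1) := hA.inter measurableSet_Ico
  have hd : IntegrableOn (fun x => ‖u x - g x‖ + ε) (Set.Icc 0 1) :=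
    (Integrable.sub hu hg3).norm.add (integrable_const ε)
  unfold II
  rw [← integral_sub (hu.mono_set hsub) (II_integrable hN hlip hL A), ← Real.norm_eq_abs]
  calc _ ≤ ∫ x in A ∩ Set.Ico 0 1, (‖u x - g x‖ + ε) := by
        refine norm_integral_le_of_norm_le (hd.mono_set hsub) ?_
        refine (ae_restrict_iff' hAS).2 (Filter.Eventually.of_forall fun x hx => ?_)
        have hx0 := hx.2.1
        have hpos : 0 < x + N := by positivity
        have e : max ((x + N) * p.eval x) 0 / (x + N) = max (p.eval x) 0 := by
          rw [div_eq_iff hpos.ne', max_mul_of_nonneg _ _ hpos.le, zero_mul, mul_comm]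
        have e2 : u x = max (u x) 0 := (max_eq_left (hu0 x)).symm
        rw [e, Real.norm_eq_abs, Real.norm_eq_abs]
        have q1 : |u x - max (p.eval x) 0| ≤ |u x - p.eval x| := by
          conv_lhs => rw [e2]
          exact abs_max_sub_max_le_abs _ _ _
        have q2 := hp x (hsub hx)
        have q3 := abs_sub_le (u x) (g x) (p.eval x)
        rw [abs_sub_comm (g x)] at q3
        linarith
    _ ≤ ∫ x in Set.Icc 0 1, (‖u x - g x‖ + ε) := by
        refine setIntegral_mono_set hd (Filter.Eventually.of_forall fun x => ?_)
          hsub.eventuallyLE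
        simp only [Pi.zero_apply]; positivity
    _ ≤ 2 * ε := by
        have hi : Integrable (fun x => ‖u x - g x‖) (volume.restrict (Set.Icc 0 1)) :=
          (Integrable.sub hu hg3).norm
        rw [integral_add hi (integrable_const ε)]
        simp
        simp only [Real.norm_eq_abs] at hg1
        linarith

theorem gauss_kuzmin_N_continued_fractions (N : ℕ) (hN : 1 ≤ N)
    (μ : Measure ℝ) [IsProbabilityMeasure μ] (h : ℝ → ℝ)
    (hdens : μ = (volume.restrict (Set.Icc (0 : ℝ) 1)).withDensity
      (fun x => ENNReal.ofReal (h x)))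
    (hbdd : ∃ C : ℝ, ∀ x ∈ Set.Icc (0 : ℝ) 1, |h x| ≤ C)
    (hae : ∀ᵐ x ∂(volume.restrict (Set.Icc (0 : ℝ) 1)), ContinuousAt h x) :
    ∀ x ∈ Set.Icc (0 : ℝ) 1,
      Filter.Tendsto (fun n => (μ ((TN N)^[n] ⁻¹' (Set.Ico 0 x))).toReal)
        Filter.atTop
        (nhds (Real.log ((x + N) / N) / Real.log ((N + 1) / N))) := by
  intro x hx
  obtain ⟨C, hC⟩ := hbdd
  set u : ℝ → ℝ := fun x => max (h x) 0 with hu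
  have hum : AEMeasurable u (volume.restrict (Set.Icc (0 : ℝ) 1)) :=
    (aemeas_of_ae_cont hae).max aemeasurable_const
  have hu0 : ∀ x, 0 ≤ u x := fun x => le_max_right _ _
  have hui : IntegrableOn u (Set.Icc 0 1) := by
    refine Integrable.of_bound hum.aestronglyMeasurable C ?_
    refine (ae_restrict_iff' measurableSet_Icc).2 (Filter.Eventually.of_forall fun x hx => ?_)
    rw [Real.norm_eq_abs, abs_of_nonneg (hu0 x)]
    exact max_le ((le_abs_self _).trans (hC x hx)) ((abs_nonneg _).trans (hC x hx))
  have hμ : ∀ A, MeasurableSet A → (μ A).toReal = ∫ x in A ∩ Set.Ico 0 1, u x := by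
    intro A hA
    have e : ∫ x in A ∩ Set.Ico 0 1, u x = ∫ x in A ∩ Set.Icc 0 1, u x :=
      setIntegral_congr_set ((Filter.EventuallyEq.refl _ _).inter Ico_ae_eq_Icc)
    rw [e, integral_eq_lintegral_of_nonneg_ae (Filter.Eventually.of_forall hu0)
      (hui.mono_set Set.inter_subset_right).aestronglyMeasurable, hdens, withDensity_apply _ hA,
      Measure.restrict_restrict hA]
    congr 2
    funext x
    simp [hu, ENNReal.ofReal_max]
  set ρ := Real.log ((x + N) / N) / Real.log ((N + 1) / N) with hρ
  rw [Metric.tendsto_atTop]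
  intro δ hδ
  set ε := δ / (4 * (1 + |ρ|)) with hε
  have hεpos : 0 < ε := by positivity
  obtain ⟨f, L, hL, hlip, hf0, hA⟩ := approx hN hui hu0 hεpos
  have hlim := lip_limit hN hlip hL hf0 hx
  rw [Metric.tendsto_atTop] at hlim
  obtain ⟨n0, hn0⟩ := hlim (δ / 2) (by positivity)
  refine ⟨n0, fun n hn => ?_⟩
  have c1 := hn0 n hn
  have hms := (TN_meas N).iterate n (measurableSet_Ico (a := (0:ℝ)) (b := x))
  have c2 := hA _ hms
  have c3 := hA _ MeasurableSet.univ
  rw [← hμ _ hms] at c2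
  rw [← hμ _ MeasurableSet.univ, measure_univ, ENNReal.toReal_one] at c3
  rw [Real.dist_eq] at c1 ⊢
  set M := (μ ((TN N)^[n] ⁻¹' (Set.Ico 0 x))).toReal
  set J := II N f ((TN N)^[n] ⁻¹' (Set.Ico 0 x))
  set K := II N f Set.univ
  have e : M - ρ = (M - J) + (J - ρ * K) - ρ * (1 - K) := by ring
  have b1 : |M - ρ| ≤ |M - J| + |J - ρ * K| + |ρ| * |1 - K| := by
    rw [e, ← abs_mul]
    exact (abs_sub _ _).trans (add_le_add_left (abs_add_le _ _) _)
  have b2 := mul_le_mul_of_nonneg_left c3 (abs_nonneg ρ)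
  have b3 : 2 * ε * (1 + |ρ|) = δ / 2 := by
    rw [hε]; field_simp; norm_num
  linarith
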